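/- Let n ≥ 1 and let S ⊆ ℝ^n be a Borel set with S ∩ (−S) = ∅ and λ = Vol_n(S) ∈ (0, ∞). Let μ be any SL_n(ℝ)-invariant Borel probability measure on the space 𝒳_n of covolume-one lattices in ℝ^n. Then for every integer k with 0 ≤ k ≤ n − 1, ∫_{𝒳_n} ρ_k^k(L ∩ S) dμ(L) = λ^k / k!, the integrand being defined for μ-almost every L (L ∩ S is finite for μ-almost every L). -/

import Mathlib

open MeasureTheory Pointwise
open scoped ENNReal

noncomputable section

/-- `SL(n, ℝ)`, the special linear group of `n × n` real matrices of determinant one. -/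
abbrev SLR (n : ℕ) := Matrix.SpecialLinearGroup (Fin n) ℝ

/-- The topology on `SL(n, ℝ)` induced from the space of matrices. -/
instance (n : ℕ) : TopologicalSpace (SLR n) :=
  TopologicalSpace.induced (fun g => (g : Matrix (Fin n) (Fin n) ℝ)) inferInstance

/-- The subgroup `SL(n, ℤ)` of `SL(n, ℝ)` (the range of the coefficient-wise
integer-to-real map on special linear groups). -/
def SLZ (n : ℕ) : Subgroup (SLR n) :=
  MonoidHom.range (Matrix.SpecialLinearGroup.map (n := Fin n) (Int.castRingHom ℝ))

/-- The space `𝒳ₙ = SL(n, ℝ) / SL(n, ℤ)` of lattices of covolume one in `ℝⁿ`. -/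
def LatticeSpace (n : ℕ) := SLR n ⧸ SLZ n

instance (n : ℕ) : TopologicalSpace (LatticeSpace n) :=
  inferInstanceAs (TopologicalSpace (SLR n ⧸ SLZ n))

/-- The Borel σ-algebra on the space of lattices. -/
instance (n : ℕ) : MeasurableSpace (LatticeSpace n) := borel _

/-- The action of `SL(n, ℝ)` on the space of lattices, `g.L = {g x : x ∈ L}`. -/
instance (n : ℕ) : MulAction (SLR n) (LatticeSpace n) :=
  inferInstanceAs (MulAction (SLR n) (SLR n ⧸ SLZ n))

/-- The lattice `{g v : v ∈ ℤⁿ} ⊆ ℝⁿ` associated to a point of `LatticeSpace n`,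
computed via a representative `g` of the coset (the resulting set of vectors does not
depend on the choice of representative, since `SL(n, ℤ)` preserves `ℤⁿ`). -/
def latticeOf {n : ℕ} (L : LatticeSpace n) : Set (Fin n → ℝ) :=
  {y | ∃ v : Fin n → ℤ,
    y = (Quotient.out (α := SLR n) L).1.mulVec (fun i => (v i : ℝ))}

/-- `rank X`: the dimension of the linear span of `X ⊆ ℝⁿ`. -/
def rankOf {n : ℕ} (X : Set (Fin n → ℝ)) : ℕ :=
  Module.finrank ℝ ↥(Submodule.span ℝ X)

/-- `ρₖʲ(A)`: the number of subsets `X ⊆ A` with `|X| = k` and `rank X = j`. -/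
def rho {n : ℕ} (k j : ℕ) (A : Set (Fin n → ℝ)) : ℕ :=
  Set.ncard {X : Set (Fin n → ℝ) | X ⊆ A ∧ X.ncard = k ∧ rankOf X = j}

section MeanValue

open Filter Topology
open scoped NNReal

instance (n : ℕ) : MeasurableSpace (SLR n) := borel _
instance (n : ℕ) : BorelSpace (SLR n) := ⟨rfl⟩
instance (n : ℕ) : BorelSpace (LatticeSpace n) := ⟨rfl⟩

instance (n : ℕ) : IsTopologicalGroup (SLR n) :=
  Matrix.SpecialLinearGroup.topologicalGroup

lemma isClosedEmbedding_coe (n : ℕ) :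
    Topology.IsClosedEmbedding (fun g : SLR n => (g : Matrix (Fin n) (Fin n) ℝ)) := by
  refine Topology.IsClosedEmbedding.mk ⟨⟨rfl⟩, Subtype.val_injective⟩ ?_
  have : Set.range (fun g : SLR n => (g : Matrix (Fin n) (Fin n) ℝ)) = {A | A.det = 1} :=
    Subtype.range_val
  rw [this]
  exact isClosed_eq (continuous_id.matrix_det) continuous_const

instance (n : ℕ) : PolishSpace (SLR n) :=
  haveI : PolishSpace (Matrix (Fin n) (Fin n) ℝ) := inferInstanceAs (PolishSpace (Fin n → Fin n → ℝ))
  (isClosedEmbedding_coe n).polishSpace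

lemma isClosed_SLZ (n : ℕ) : IsClosed (SLZ n : Set (SLR n)) := by
  have : (SLZ n : Set (SLR n)) = ⋂ i, ⋂ j, {g : SLR n | g.1 i j ∈ Set.range ((↑) : ℤ → ℝ)} := by
    ext g
    simp only [Set.mem_iInter, Set.mem_ofPred_eq]
    constructor
    · rintro ⟨a, rfl⟩ i j
      exact ⟨a.1 i j, by simp⟩
    · intro h
      choose a ha using h
      have hm : (Matrix.of a).map (Int.castRingHom ℝ) = g.1 := by
        ext i j; simp [ha]
      refine ⟨⟨Matrix.of a, ?_⟩, ?_⟩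
      · have : (((Matrix.of a).det : ℤ) : ℝ) = 1 := by
          rw [← g.2, ← hm, ← RingHom.mapMatrix_apply, ← RingHom.map_det]; simp
        exact_mod_cast this
      · ext i j
        exact ha i j
  rw [this]
  refine isClosed_iInter fun i => isClosed_iInter fun j => ?_
  have hc : Continuous (fun g : SLR n => g.1 i j) :=
    (continuous_id.matrix_elem i j).comp (isClosedEmbedding_coe n).continuous
  exact Int.isClosedEmbedding_coe_real.isClosed_range.preimage hc

instance (n : ℕ) : T1Space (LatticeSpace n) :=
  haveI : IsClosed (SLZ n : Set (SLR n)) := isClosed_SLZ n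
  inferInstanceAs (T1Space (SLR n ⧸ SLZ n))

instance (n : ℕ) : SecondCountableTopology (LatticeSpace n) :=
  inferInstanceAs (SecondCountableTopology (SLR n ⧸ SLZ n))

instance (n : ℕ) : ContinuousSMul (SLR n) (LatticeSpace n) :=
  inferInstanceAs (ContinuousSMul (SLR n) (SLR n ⧸ SLZ n))

def toLat {n : ℕ} (g : SLR n) : LatticeSpace n := (QuotientGroup.mk g : SLR n ⧸ SLZ n)

lemma measurable_of_comp_toLat {n : ℕ} {α : Type*} [MeasurableSpace α] {f : LatticeSpace n → α}
    (h : Measurable (f ∘ toLat)) : Measurable f := by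
  have hc : Continuous (toLat : SLR n → LatticeSpace n) := QuotientGroup.continuous_mk
  have hs : Function.Surjective (toLat : SLR n → LatticeSpace n) := QuotientGroup.mk_surjective
  have := hc.map_eq_borel hs
  intro s hs
  rw [← BorelSpace.measurable_eq (α := LatticeSpace n)] at this
  rw [← this]
  exact h hs

def actTuple {ι m : Type*} [Fintype m] (g : Matrix m m ℝ) (M : ι → m → ℝ) : ι → m → ℝ :=
  fun i => g.mulVec (M i)

def castTuple {ι m : Type*} (z : ι → m → ℤ) : ι → m → ℝ := fun i j => (z i j : ℝ)

lemma actTuple_mul {ι m : Type*} [Fintype m] (g h : Matrix m m ℝ) (M : ι → m → ℝ) :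
    actTuple (g * h) M = actTuple g (actTuple h M) := by
  funext i
  simp [actTuple, Matrix.mulVec_mulVec]

lemma actTuple_one {ι m : Type*} [Fintype m] [DecidableEq m] (M : ι → m → ℝ) :
    actTuple (1 : Matrix m m ℝ) M = M := by
  funext i
  simp [actTuple]

lemma continuous_actTuple {ι m Y : Type*} [Fintype m] [TopologicalSpace Y]
    {g : Y → Matrix m m ℝ} {M : Y → ι → m → ℝ} (hg : Continuous g) (hM : Continuous M) :
    Continuous (fun y => actTuple (g y) (M y)) := by
  refine continuous_pi fun i => ?_
  exact hg.matrix_mulVec ((continuous_apply i).comp hM)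

/-- The sum of `f` over the `k`-tuples of vectors in the lattice `L`. -/
def latticeSum {n k : ℕ} (L : LatticeSpace n) (f : (Fin k → Fin n → ℝ) → ℝ≥0∞) : ℝ≥0∞ :=
  ∑' z : Fin k → Fin n → ℤ, f (actTuple (Quotient.out (α := SLR n) L).1 (castTuple z))

def intActEquiv {n k : ℕ} (a : Matrix.SpecialLinearGroup (Fin n) ℤ) :
    (Fin k → Fin n → ℤ) ≃ (Fin k → Fin n → ℤ) where
  toFun z i := a.1.mulVec (z i)
  invFun z i := (a⁻¹).1.mulVec (z i)
  left_inv z := by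
    funext i
    simp only [Matrix.mulVec_mulVec, ← Matrix.SpecialLinearGroup.coe_mul]
    simp
  right_inv z := by
    funext i
    simp only [Matrix.mulVec_mulVec, ← Matrix.SpecialLinearGroup.coe_mul]
    simp

lemma latticeSum_toLat {n k : ℕ} (g : SLR n) (f : (Fin k → Fin n → ℝ) → ℝ≥0∞) :
    latticeSum (toLat g) f = ∑' z : Fin k → Fin n → ℤ, f (actTuple g.1 (castTuple z)) := by
  obtain ⟨⟨γ, a, rfl⟩, h⟩ := QuotientGroup.mk_out_eq_mul (SLZ n) g
  have h' : Quotient.out (α := SLR n) (toLat g : LatticeSpace n)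
      = g * Matrix.SpecialLinearGroup.map (Int.castRingHom ℝ) a := h
  rw [latticeSum, h',
    ← (intActEquiv (k := k) a).tsum_eq (fun z => f (actTuple g.1 (castTuple z)))]
  refine tsum_congr fun z => ?_
  rw [Matrix.SpecialLinearGroup.coe_mul, actTuple_mul]
  congr 2
  funext i j
  simp [actTuple, castTuple, intActEquiv, Matrix.mulVec, dotProduct]

lemma toLat_out {n : ℕ} (L : LatticeSpace n) :
    (toLat (Quotient.out (α := SLR n) L) : LatticeSpace n) = L :=
  QuotientGroup.out_eq' (s := SLZ n) L

lemma latticeSum_smul {n k : ℕ} (g : SLR n) (L : LatticeSpace n)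
    (f : (Fin k → Fin n → ℝ) → ℝ≥0∞) :
    latticeSum (g • L) f = latticeSum L (fun M => f (actTuple g.1 M)) := by
  rw [← toLat_out L]
  have : g • (toLat (Quotient.out (α := SLR n) L) : LatticeSpace n)
    = toLat (g * Quotient.out (α := SLR n) L) := rfl
  rw [this, latticeSum_toLat, latticeSum_toLat]
  refine tsum_congr fun z => ?_
  rw [Matrix.SpecialLinearGroup.coe_mul, actTuple_mul]

lemma measurable_latticeSum {n k : ℕ} {f : (Fin k → Fin n → ℝ) → ℝ≥0∞} (hf : Measurable f) :
    Measurable (fun L : LatticeSpace n => latticeSum L f) := by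
  refine measurable_of_comp_toLat ?_
  have : ((fun L : LatticeSpace n => latticeSum L f) ∘ toLat) =
      fun g : SLR n => ∑' z : Fin k → Fin n → ℤ, f (actTuple g.1 (castTuple z)) :=
    funext fun g => latticeSum_toLat g f
  rw [this]
  refine Measurable.tsum fun z => hf.comp ?_
  exact (continuous_actTuple (isClosedEmbedding_coe n).continuous continuous_const).measurable

lemma measurePreserving_actTuple {k : Type*} {m : Type*} [Fintype k] [Fintype m] [DecidableEq m]
    (g : Matrix m m ℝ) (hg : g.det = 1) :
    MeasurePreserving (actTuple g : (k → m → ℝ) → (k → m → ℝ)) volume volume := by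
  refine volume_preserving_pi (f := fun _ => g.mulVec) fun _ => ⟨?_, ?_⟩
  · exact (continuous_const.matrix_mulVec continuous_id).measurable
  · have := Real.map_matrix_volume_pi_eq_smul_volume_pi (M := g) (by simp [hg])
    rw [hg, inv_one, abs_one, ENNReal.ofReal_one, one_smul] at this
    exact this

lemma lintegral_eq_of_tendsto_average {n : ℕ} {Ω : Type*} [MeasurableSpace Ω]
    (P : Measure Ω) [IsProbabilityMeasure P]
    (μ : Measure (LatticeSpace n)) [IsProbabilityMeasure μ]
    (hinv : ∀ g : SLR n, Measure.map (fun x => g • x) μ = μ)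
    (G : ℕ → Ω → SLR n) (hG : ∀ N, Measurable (G N))
    {Θ : LatticeSpace n → ℝ≥0∞} (hΘ : Measurable Θ) (I : ℝ≥0∞)
    (hlim : ∀ L, Tendsto (fun N => ∫⁻ x, Θ (G N x • L) ∂P) atTop (𝓝 I)) :
    ∫⁻ L, Θ L ∂μ = I := by
  have hjm (N : ℕ) : Measurable (fun p : LatticeSpace n × Ω => G N p.2 • p.1) := by
    have hs : Continuous (fun q : SLR n × LatticeSpace n => q.1 • q.2) := continuous_smul
    exact hs.measurable.comp (((hG N).comp measurable_snd).prodMk measurable_fst)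
  have hinvI (g : SLR n) {F : LatticeSpace n → ℝ≥0∞} (hF : Measurable F) :
      ∫⁻ L, F (g • L) ∂μ = ∫⁻ L, F L ∂μ := by
    conv_rhs => rw [← hinv g]
    rw [lintegral_map hF (continuous_const_smul g).measurable]
  have havg (N : ℕ) {F : LatticeSpace n → ℝ≥0∞} (hF : Measurable F) :
      ∫⁻ L, ∫⁻ x, F (G N x • L) ∂P ∂μ = ∫⁻ L, F L ∂μ := by
    rw [lintegral_lintegral_swap (f := fun L x => F (G N x • L)) (hF.comp (hjm N)).aemeasurable]
    simp [hinvI _ hF]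
  have hAm (N : ℕ) {F : LatticeSpace n → ℝ≥0∞} (hF : Measurable F) :
      Measurable (fun L => ∫⁻ x, F (G N x • L) ∂P) :=
    (hF.comp (hjm N)).lintegral_prod_right'
  refine le_antisymm ?_ ?_
  · have hM (M : ℕ) : ∫⁻ L, min (M : ℝ≥0∞) (Θ L) ∂μ ≤ I := by
      have hm : Measurable (fun L => min (M : ℝ≥0∞) (Θ L)) := measurable_const.min hΘ
      have h1 (N : ℕ) : ∫⁻ L, min (M : ℝ≥0∞) (Θ L) ∂μ
          ≤ ∫⁻ L, min (M : ℝ≥0∞) (∫⁻ x, Θ (G N x • L) ∂P) ∂μ := by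
        rw [← havg N hm]
        refine lintegral_mono fun L => le_min ?_ ?_
        · calc _ ≤ ∫⁻ _, (M : ℝ≥0∞) ∂P := lintegral_mono fun x => min_le_left _ _
            _ = M := by simp
        · exact lintegral_mono fun x => min_le_right _ _
      have h2 : Tendsto (fun N => ∫⁻ L, min (M : ℝ≥0∞) (∫⁻ x, Θ (G N x • L) ∂P) ∂μ) atTop
          (𝓝 (∫⁻ _, min (M : ℝ≥0∞) I ∂μ)) := by
        refine tendsto_lintegral_of_dominated_convergence (fun _ => (M : ℝ≥0∞))
          (fun N => measurable_const.min (hAm N hΘ)) (fun N => ?_) (by simp) ?_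
        · exact Eventually.of_forall fun L => min_le_left _ _
        · exact Eventually.of_forall fun L => tendsto_const_nhds.min (hlim L)
      refine (ge_of_tendsto' h2 h1).trans ?_
      simp
    have hsup : ∫⁻ L, Θ L ∂μ = ⨆ M : ℕ, ∫⁻ L, min (M : ℝ≥0∞) (Θ L) ∂μ := by
      rw [← lintegral_iSup (fun M => measurable_const.min hΘ)]
      · refine lintegral_congr fun L => ?_
        rw [← iSup_inf_eq, ENNReal.iSup_natCast, top_inf_eq]
      · intro a b hab L
        exact min_le_min_right _ (by exact_mod_cast hab)
    rw [hsup]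
    exact iSup_le hM
  · calc I = ∫⁻ L, liminf (fun N => ∫⁻ x, Θ (G N x • L) ∂P) atTop ∂μ := by
          simp [fun L => (hlim L).liminf_eq]
      _ ≤ liminf (fun N => ∫⁻ L, ∫⁻ x, Θ (G N x • L) ∂P ∂μ) atTop :=
          lintegral_liminf_le fun N => hAm N hΘ
      _ = ∫⁻ L, Θ L ∂μ := by simp [havg _ hΘ]

/-- The coordinatewise integer part of `r • M`. -/
def floorTuple {ι ν : Type*} (r : ℝ) (M : ι → ν → ℝ) : ι → ν → ℤ := fun i j => ⌊r * M i j⌋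

lemma measurable_floorTuple {ι ν : Type*} (r : ℝ) :
    Measurable (floorTuple r : (ι → ν → ℝ) → (ι → ν → ℤ)) := by
  refine measurable_pi_lambda _ fun i => measurable_pi_lambda _ fun j => ?_
  refine Int.measurable_floor.comp (Measurable.const_mul ?_ r)
  exact (measurable_pi_apply j).comp (measurable_pi_apply i)

lemma volume_floorTuple_preimage {ι ν : Type*} [Fintype ι] [Fintype ν] {r : ℝ} (hr : 0 < r)
    (z : ι → ν → ℤ) :
    volume (floorTuple r ⁻¹' {z}) = ENNReal.ofReal (r⁻¹ ^ (Fintype.card ι * Fintype.card ν)) := by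
  have : floorTuple r ⁻¹' {z} = Set.univ.pi fun i => Set.univ.pi fun j =>
      Set.Ico (r⁻¹ * z i j) (r⁻¹ * (z i j + 1)) := by
    ext M
    simp only [Set.mem_preimage, Set.mem_singleton_iff, Set.mem_pi, Set.mem_univ, true_imp_iff,
      Set.mem_Ico, floorTuple, funext_iff, Int.floor_eq_iff, inv_mul_le_iff₀ hr, lt_inv_mul_iff₀ hr]
  rw [this, volume_pi_pi]
  simp_rw [Real.volume_pi_Ico, ← mul_sub, add_sub_cancel_left, mul_one, Finset.prod_const]
  rw [Finset.card_univ, Finset.card_univ, ← pow_mul, ENNReal.ofReal_pow (by positivity), mul_comm]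

lemma tsum_eq_lintegral_floorTuple {ι ν : Type*} [Fintype ι] [Fintype ν] {r : ℝ} (hr : 0 < r)
    (φ : (ι → ν → ℤ) → ℝ≥0∞) :
    ∑' z, φ z = ∫⁻ M : ι → ν → ℝ,
      ENNReal.ofReal (r ^ (Fintype.card ι * Fintype.card ν)) * φ (floorTuple r M) := by
  have hφ : Measurable φ := measurable_of_countable φ
  rw [lintegral_const_mul (μ := (volume : Measure (ι → ν → ℝ)))
      (f := fun M => φ (floorTuple r M)) _ (hφ.comp (measurable_floorTuple r)),
    ← lintegral_map hφ (measurable_floorTuple r), lintegral_countable', ← ENNReal.tsum_mul_left]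
  refine tsum_congr fun z => ?_
  rw [Measure.map_apply (measurable_floorTuple r) (measurableSet_singleton z),
    volume_floorTuple_preimage hr, mul_left_comm, ← ENNReal.ofReal_mul (by positivity),
    ← mul_pow, mul_inv_cancel₀ hr.ne']
  simp

lemma dist_floorTuple_le {ι ν : Type*} [Fintype ι] [Fintype ν] {r : ℝ} (hr : 0 < r)
    (M : ι → ν → ℝ) : dist (r⁻¹ • castTuple (floorTuple r M)) M ≤ r⁻¹ := by
  have h0 : 0 ≤ r⁻¹ := by positivity
  refine (dist_pi_le_iff h0).2 fun i => (dist_pi_le_iff h0).2 fun j => ?_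
  have h1 := Int.floor_le (r * M i j)
  have h2 := Int.lt_floor_add_one (r * M i j)
  have : (r⁻¹ • castTuple (floorTuple r M)) i j - M i j = r⁻¹ * (⌊r * M i j⌋ - r * M i j) := by
    simp only [Pi.smul_apply, castTuple, floorTuple, smul_eq_mul]
    field_simp
  rw [Real.dist_eq, this, abs_mul, abs_of_nonneg h0]
  refine mul_le_of_le_one_right h0 (abs_le.2 ⟨by linarith, by linarith⟩)

section Blocks

variable {ι κ ν : Type*} (σ : κ ⊕ ι ≃ ν)

def freeBlock (M : ι → ν → ℝ) : Matrix ι κ ℝ := Matrix.of fun i a => M i (σ (Sum.inl a))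

def pivotBlock (M : ι → ν → ℝ) : Matrix ι ι ℝ := Matrix.of fun i j => M i (σ (Sum.inr j))

def glueBlocks (P : Matrix ι κ ℝ) (Q : Matrix ι ι ℝ) : ι → ν → ℝ :=
  fun i j => Sum.elim (P i) (Q i) (σ.symm j)

lemma glueBlocks_self (M : ι → ν → ℝ) :
    glueBlocks σ (freeBlock σ M) (pivotBlock σ M) = M := by
  funext i j
  obtain ⟨j, rfl⟩ := σ.surjective j
  cases j <;> simp [glueBlocks, freeBlock, pivotBlock]

@[simp] lemma freeBlock_glueBlocks (P : Matrix ι κ ℝ) (Q : Matrix ι ι ℝ) :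
    freeBlock σ (glueBlocks σ P Q) = P := by
  ext i a; simp [glueBlocks, freeBlock]

@[simp] lemma pivotBlock_glueBlocks (P : Matrix ι κ ℝ) (Q : Matrix ι ι ℝ) :
    pivotBlock σ (glueBlocks σ P Q) = Q := by
  ext i a; simp [glueBlocks, pivotBlock]

lemma continuous_freeBlock : Continuous (freeBlock σ : (ι → ν → ℝ) → Matrix ι κ ℝ) :=
  continuous_matrix fun i a => continuous_apply_apply i (σ (Sum.inl a))

lemma continuous_pivotBlock : Continuous (pivotBlock σ : (ι → ν → ℝ) → Matrix ι ι ℝ) :=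
  continuous_matrix fun i a => continuous_apply_apply i (σ (Sum.inr a))

lemma continuous_glueBlocks :
    Continuous (fun p : Matrix ι κ ℝ × Matrix ι ι ℝ => glueBlocks σ p.1 p.2) := by
  refine continuous_pi fun i => continuous_pi fun j => ?_
  obtain ⟨j, rfl⟩ := σ.surjective j
  cases j with
  | inl a => simpa [glueBlocks] using continuous_fst.matrix_elem i a
  | inr a => simpa [glueBlocks] using continuous_snd.matrix_elem i a

/-- The matrix sending the blocks `(P, Q)` of a tuple to `(a • (P + Q * t), b • Q)`. -/
def shearMatrix [DecidableEq ι] [DecidableEq κ] (a b : ℝ) (t : Matrix ι κ ℝ) : Matrix ν ν ℝ :=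
  Matrix.reindex σ σ (Matrix.fromBlocks (a • 1) (a • t.transpose) 0 (b • 1))

lemma continuous_shearMatrix [DecidableEq ι] [DecidableEq κ] (a b : ℝ) :
    Continuous (shearMatrix σ a b : Matrix ι κ ℝ → Matrix ν ν ℝ) := by
  have : Continuous fun t : Matrix ι κ ℝ =>
      Matrix.fromBlocks (a • (1 : Matrix κ κ ℝ)) (a • t.transpose) 0 (b • (1 : Matrix ι ι ℝ)) :=
    Continuous.matrix_fromBlocks continuous_const
      (continuous_id.matrix_transpose.const_smul a) continuous_const continuous_const
  exact this.matrix_reindex σ σ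

variable [Fintype ι] [DecidableEq ι] [Fintype ν]

lemma volume_det_pivotBlock_eq_zero :
    volume {M : ι → ν → ℝ | (pivotBlock σ M).det = 0} = 0 := by
  set E := {M : ι → ν → ℝ | (pivotBlock σ M).det = 0} with hE
  have hEm : MeasurableSet E :=
    (isClosed_eq (continuous_pivotBlock σ).matrix_det continuous_const).measurableSet
  let M₀ : ι → ν → ℝ := glueBlocks σ 0 1
  have hadd (t : ℝ) (M : ι → ν → ℝ) : pivotBlock σ (t • M₀ + M)
      = algebraMap ℝ (Matrix ι ι ℝ) t - (-pivotBlock σ M) := by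
    have : pivotBlock σ (t • M₀ + M) = t • pivotBlock σ M₀ + pivotBlock σ M := rfl
    rw [this, pivotBlock_glueBlocks, sub_neg_eq_add, Algebra.algebraMap_eq_smul_one]
  have hcont : Measurable fun p : (ι → ν → ℝ) × ℝ => p.2 • M₀ + p.1 :=
    ((continuous_snd.smul continuous_const).add continuous_fst).measurable
  have hind : Measurable (E.indicator (1 : (ι → ν → ℝ) → ℝ≥0∞)) := measurable_one.indicator hEm
  have h1 : ∫⁻ M : ι → ν → ℝ, ∫⁻ t : ℝ, E.indicator 1 (t • M₀ + M) = 0 := by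
    refine (lintegral_congr fun M => ?_).trans lintegral_zero
    have hfin : {t : ℝ | t • M₀ + M ∈ E}.Finite := by
      refine (Matrix.finite_spectrum (-pivotBlock σ M)).subset fun t ht => ?_
      rw [spectrum.mem_iff, ← hadd, Matrix.isUnit_iff_isUnit_det]
      have : (pivotBlock σ (t • M₀ + M)).det = 0 := ht
      simp [this]
    have : (fun t : ℝ => E.indicator (1 : (ι → ν → ℝ) → ℝ≥0∞) (t • M₀ + M))
        = {t : ℝ | t • M₀ + M ∈ E}.indicator 1 := rfl
    rw [this, lintegral_indicator_one hfin.measurableSet, hfin.measure_zero]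
  rw [lintegral_lintegral_swap (f := fun M t => E.indicator (1 : (ι → ν → ℝ) → ℝ≥0∞) (t • M₀ + M))
    (hind.comp hcont).aemeasurable] at h1
  simp_rw [fun t : ℝ => lintegral_add_left_eq_self (μ := (volume : Measure (ι → ν → ℝ)))
    (E.indicator (1 : (ι → ν → ℝ) → ℝ≥0∞)) (t • M₀), lintegral_indicator_one hEm] at h1
  simpa using h1

variable [Fintype κ] [DecidableEq κ]

lemma actTuple_shearMatrix (a b : ℝ) (t : Matrix ι κ ℝ) (M : ι → ν → ℝ) :
    actTuple (shearMatrix σ a b t) M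
      = glueBlocks σ (a • (freeBlock σ M + pivotBlock σ M * t)) (b • pivotBlock σ M) := by
  funext i j
  obtain ⟨j, rfl⟩ := σ.surjective j
  simp only [actTuple, shearMatrix, Matrix.mulVec, dotProduct, Matrix.reindex_apply]
  rw [← σ.sum_comp, Fintype.sum_sum_type]
  cases j with
  | inl c =>
    simp [glueBlocks, freeBlock, pivotBlock, Matrix.mul_apply, Matrix.one_apply,
      Finset.mul_sum, mul_assoc, mul_comm]
  | inr c =>
    simp [glueBlocks, pivotBlock, Matrix.one_apply]

lemma det_shearMatrix [DecidableEq ν] (a b : ℝ) (t : Matrix ι κ ℝ) :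
    (shearMatrix σ a b t).det = a ^ Fintype.card κ * b ^ Fintype.card ι := by
  rw [shearMatrix, Matrix.det_reindex_self, Matrix.det_fromBlocks_zero₂₁]
  simp

end Blocks

lemma lintegral_comp_smul_add {E : Type*} [NormedAddCommGroup E] [NormedSpace ℝ E]
    [MeasurableSpace E] [BorelSpace E] [FiniteDimensional ℝ E] (ν : Measure E)
    [ν.IsAddHaarMeasure] {β : ℝ} (hβ : 0 < β) (w : E) {F φ : E → ℝ≥0∞} (hF : Measurable F)
    (hφ : Measurable φ) :
    ENNReal.ofReal (β ^ Module.finrank ℝ E) * ∫⁻ t, F (β • (w + t)) * φ t ∂ν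
      = ∫⁻ y, F y * φ (β⁻¹ • y - w) ∂ν := by
  have h1 : ∫⁻ t, F (β • (w + t)) * φ t ∂ν = ∫⁻ t, F (β • t) * φ (t - w) ∂ν := by
    rw [← lintegral_add_left_eq_self (fun t => F (β • t) * φ (t - w)) w]
    simp
  have hm : Measurable fun y => F y * φ (β⁻¹ • y - w) := by fun_prop
  have h2 : ∫⁻ t, F (β • t) * φ (t - w) ∂ν
      = ∫⁻ y, F y * φ (β⁻¹ • y - w) ∂(Measure.map (fun x => β • x) ν) := by
    rw [lintegral_map hm (by fun_prop)]
    simp [smul_smul, inv_mul_cancel₀ hβ.ne']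
  rw [h1, h2, Measure.map_addHaar_smul _ hβ.ne', lintegral_smul_measure, smul_eq_mul,
    ← mul_assoc, ← ENNReal.ofReal_mul (by positivity), abs_of_nonneg (by positivity),
    mul_inv_cancel₀ (by positivity)]
  simp

section Kernel

variable {ι κ ν : Type*} [Fintype ι] [Fintype κ] [DecidableEq ι] (σ : κ ⊕ ι ≃ ν)

def slopeBlock (M : ι → ν → ℝ) : ι → κ → ℝ := ((pivotBlock σ M)⁻¹ * freeBlock σ M : Matrix ι κ ℝ)

/-- The rescaled average over shears of a function `f`, at inverse scale `η`. -/
def shearAverage (f : (ι → ν → ℝ) → ℝ≥0) (ψ : (ι → κ → ℝ) → ℝ≥0) (η : ℝ) (M : ι → ν → ℝ) : ℝ≥0∞ :=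
  ∫⁻ y : ι → κ → ℝ,
    ((f (glueBlocks σ (pivotBlock σ M * Matrix.of y) (pivotBlock σ M)) : ℝ≥0) : ℝ≥0∞) *
      (ψ (η • y - slopeBlock σ M) : ℝ≥0)

variable {f : (ι → ν → ℝ) → ℝ≥0} {ψ : (ι → κ → ℝ) → ℝ≥0}

lemma continuous_of_matrix {ι κ : Type*} :
    Continuous (fun y : ι → κ → ℝ => (Matrix.of y : Matrix ι κ ℝ)) := continuous_id

lemma exists_norm_le_of_glueBlocks_ne_zero (hfc : HasCompactSupport f)
    (hfU : tsupport f ⊆ {M | (pivotBlock σ M).det ≠ 0}) :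
    ∃ R : ℝ, ∀ (Q : Matrix ι ι ℝ) (y : ι → κ → ℝ),
      f (glueBlocks σ (Q * Matrix.of y) Q) ≠ 0 → ‖y‖ ≤ R := by
  have hc : ContinuousOn (slopeBlock σ)  (tsupport f) := by
    intro M hM
    have hM' : (pivotBlock σ M).det ≠ 0 := hfU hM
    refine ContinuousAt.continuousWithinAt ?_
    have h1 : ContinuousAt (fun M => (pivotBlock σ M)⁻¹) M :=
      ContinuousAt.comp (g := fun A : Matrix ι ι ℝ => A⁻¹)
        (continuousAt_matrix_inv _ (by simpa using continuousAt_inv₀ hM'))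
        (continuous_pivotBlock σ).continuousAt
    have h2 : Continuous fun p : Matrix ι ι ℝ × Matrix ι κ ℝ => (p.1 * p.2 : Matrix ι κ ℝ) :=
      continuous_fst.matrix_mul continuous_snd
    exact ContinuousAt.comp (g := fun p : Matrix ι ι ℝ × Matrix ι κ ℝ => (p.1 * p.2 : Matrix ι κ ℝ))
      h2.continuousAt (h1.prodMk (continuous_freeBlock σ).continuousAt)
  obtain ⟨R, hR⟩ := (hfc.isCompact.image_of_continuousOn hc).isBounded.exists_norm_le
  refine ⟨R, fun Q y hy => ?_⟩
  have hmem := subset_tsupport f hy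
  have hdet : IsUnit Q.det := by
    have := hfU hmem
    simp only [Set.mem_ofPred_eq, pivotBlock_glueBlocks] at this
    exact this.isUnit
  have := hR _ ⟨_, hmem, rfl⟩
  simp only [slopeBlock, pivotBlock_glueBlocks, freeBlock_glueBlocks] at this
  rwa [Matrix.nonsing_inv_mul_cancel_left _ _ hdet] at this

lemma exists_bound_shearAverage (hf : Continuous f) (hfc : HasCompactSupport f)
    (hfU : tsupport f ⊆ {M | (pivotBlock σ M).det ≠ 0})
    (hψ : Continuous ψ) (hψc : HasCompactSupport ψ) :
    ∃ C : ℝ≥0, ∀ η M, shearAverage σ f ψ η M ≤ C := by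
  obtain ⟨R, hR⟩ := exists_norm_le_of_glueBlocks_ne_zero σ hfc hfU
  obtain ⟨A, hA⟩ := (hfc.isCompact_range hf).bddAbove
  obtain ⟨B, hB⟩ := (hψc.isCompact_range hψ).bddAbove
  have hfin : volume (Metric.closedBall (0 : ι → κ → ℝ) R) ≠ ∞ := measure_closedBall_lt_top.ne
  refine ⟨A * B * (volume (Metric.closedBall (0 : ι → κ → ℝ) R)).toNNReal, fun η M => ?_⟩
  calc shearAverage σ f ψ η M
      ≤ ∫⁻ y, (Metric.closedBall (0 : ι → κ → ℝ) R).indicator (fun _ => ((A * B : ℝ≥0) : ℝ≥0∞)) y := by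
        refine lintegral_mono fun y => ?_
        by_cases hy : f (glueBlocks σ (pivotBlock σ M * Matrix.of y) (pivotBlock σ M)) = 0
        · simp [hy]
        · rw [Set.indicator_of_mem (by simpa using hR _ _ hy), ← ENNReal.coe_mul]
          exact ENNReal.coe_le_coe.2 (mul_le_mul' (hA ⟨_, rfl⟩) (hB ⟨_, rfl⟩))
    _ = _ := by
        rw [lintegral_indicator_const Metric.isClosed_closedBall.measurableSet]
        push_cast
        rw [ENNReal.coe_toNNReal hfin]

lemma exists_norm_le_of_shearAverage_ne_zero [Fintype ν] (hfc : HasCompactSupport f)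
    (hfU : tsupport f ⊆ {M | (pivotBlock σ M).det ≠ 0}) (hψc : HasCompactSupport ψ) :
    ∃ R : ℝ, ∀ η M, 0 ≤ η → η ≤ 1 → shearAverage σ f ψ η M ≠ 0 → ‖M‖ ≤ R := by
  obtain ⟨R₁, hR₁⟩ := exists_norm_le_of_glueBlocks_ne_zero σ hfc hfU
  obtain ⟨R₂, hR₂⟩ := hψc.isCompact.isBounded.exists_norm_le
  have hQc : IsCompact (pivotBlock σ '' tsupport f) :=
    hfc.isCompact.image (continuous_pivotBlock σ)
  have hwc : IsCompact (Metric.closedBall (0 : ι → κ → ℝ) (R₁ + R₂)) := isCompact_closedBall _ _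
  have hcont : Continuous fun p : Matrix ι ι ℝ × (ι → κ → ℝ) =>
      glueBlocks σ (p.1 * Matrix.of p.2) p.1 :=
    (continuous_glueBlocks σ).comp
      ((continuous_fst.matrix_mul (continuous_of_matrix.comp continuous_snd)).prodMk continuous_fst)
  obtain ⟨R, hR⟩ := ((hQc.prod hwc).image hcont).isBounded.exists_norm_le
  refine ⟨R, fun η M h0 h1 hM => ?_⟩
  have : ∃ y : ι → κ → ℝ, f (glueBlocks σ (pivotBlock σ M * Matrix.of y) (pivotBlock σ M)) ≠ 0 ∧
      ψ (η • y - slopeBlock σ M) ≠ 0 := by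
    by_contra! hcon
    refine hM ((lintegral_congr fun y => ?_).trans lintegral_zero)
    by_cases hy : f (glueBlocks σ (pivotBlock σ M * Matrix.of y) (pivotBlock σ M)) = 0
    · simp [hy]
    · simp [hcon y hy]
  obtain ⟨y, hy, hψy⟩ := this
  have hmem := subset_tsupport f hy
  have hdet : IsUnit (pivotBlock σ M).det := by
    have := hfU hmem
    simp only [Set.mem_ofPred_eq, pivotBlock_glueBlocks] at this
    exact this.isUnit
  set w : ι → κ → ℝ := slopeBlock σ M with hw
  have hwn : ‖w‖ ≤ R₁ + R₂ := by
    have e : w = η • y - (η • y - w) := by abel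
    rw [e]
    refine (norm_sub_le _ _).trans (add_le_add ?_ (hR₂ _ (subset_tsupport ψ hψy)))
    rw [norm_smul, Real.norm_of_nonneg h0]
    exact (mul_le_of_le_one_left (norm_nonneg _) h1).trans (hR₁ _ _ hy)
  have hM' : glueBlocks σ (pivotBlock σ M * Matrix.of w) (pivotBlock σ M) = M := by
    have : pivotBlock σ M * Matrix.of w = freeBlock σ M :=
      Matrix.mul_nonsing_inv_cancel_left _ _ hdet
    rw [this, glueBlocks_self]
  rw [← hM']
  refine hR _ ⟨(pivotBlock σ M, w), ⟨⟨_, hmem, ?_⟩, by simpa using hwn⟩, rfl⟩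
  simp

lemma tendsto_shearAverage (hf : Continuous f) (hfc : HasCompactSupport f)
    (hfU : tsupport f ⊆ {M | (pivotBlock σ M).det ≠ 0})
    (hψ : Continuous ψ) (hψc : HasCompactSupport ψ) {η : ℕ → ℝ} (hη : Tendsto η atTop (𝓝 0))
    {M : ℕ → ι → ν → ℝ} {M₀ : ι → ν → ℝ} (hM : Tendsto M atTop (𝓝 M₀))
    (hdet : (pivotBlock σ M₀).det ≠ 0) :
    Tendsto (fun N => shearAverage σ f ψ (η N) (M N)) atTop (𝓝 (shearAverage σ f ψ 0 M₀)) := by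
  obtain ⟨R, hR⟩ := exists_norm_le_of_glueBlocks_ne_zero σ hfc hfU
  obtain ⟨A, hA⟩ := (hfc.isCompact_range hf).bddAbove
  obtain ⟨B, hB⟩ := (hψc.isCompact_range hψ).bddAbove
  have hcf (Q : Matrix ι ι ℝ) : Continuous fun y : ι → κ → ℝ =>
      f (glueBlocks σ (Q * Matrix.of y) Q) :=
    hf.comp ((continuous_glueBlocks σ).comp
      ((continuous_const.matrix_mul continuous_of_matrix).prodMk continuous_const))
  have hcψ (c : ℝ) (w : ι → κ → ℝ) : Continuous fun y => ψ (c • y - w) :=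
    hψ.comp ((continuous_id.const_smul c).sub continuous_const)
  refine tendsto_lintegral_of_dominated_convergence
    ((Metric.closedBall (0 : ι → κ → ℝ) R).indicator (fun _ => ((A * B : ℝ≥0) : ℝ≥0∞)))
    (fun N => ?_) (fun N => ?_) ?_ ?_
  · exact ((hcf _).measurable.coe_nnreal_ennreal).mul (hcψ _ _).measurable.coe_nnreal_ennreal
  · refine Eventually.of_forall fun y => ?_
    dsimp only
    by_cases hy : f (glueBlocks σ (pivotBlock σ (M N) * Matrix.of y) (pivotBlock σ (M N))) = 0
    · simp [hy]
    · rw [Set.indicator_of_mem (by simpa using hR _ _ hy), ← ENNReal.coe_mul]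
      exact ENNReal.coe_le_coe.2 (mul_le_mul' (hA ⟨_, rfl⟩) (hB ⟨_, rfl⟩))
  · rw [lintegral_indicator_const Metric.isClosed_closedBall.measurableSet]
    exact ENNReal.mul_ne_top ENNReal.coe_ne_top measure_closedBall_lt_top.ne
  · refine Eventually.of_forall fun y => ?_
    have hQ : Tendsto (fun N => pivotBlock σ (M N)) atTop (𝓝 (pivotBlock σ M₀)) :=
      ((continuous_pivotBlock σ).tendsto _).comp hM
    have hP : Tendsto (fun N => freeBlock σ (M N)) atTop (𝓝 (freeBlock σ M₀)) :=
      ((continuous_freeBlock σ).tendsto _).comp hM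
    have hQi : Tendsto (fun N => (pivotBlock σ (M N))⁻¹) atTop (𝓝 (pivotBlock σ M₀)⁻¹) :=
      (continuousAt_matrix_inv _ (by simpa using continuousAt_inv₀ hdet)).tendsto.comp hQ
    have hmul : Continuous fun p : Matrix ι ι ℝ × Matrix ι κ ℝ => (p.1 * p.2 : Matrix ι κ ℝ) :=
      continuous_fst.matrix_mul continuous_snd
    have hw : Tendsto (fun N => slopeBlock σ (M N)) atTop
        (𝓝 (slopeBlock σ M₀)) :=
      (hmul.tendsto _).comp (hQi.prodMk_nhds hP)
    have hfy : Continuous fun Q : Matrix ι ι ℝ => f (glueBlocks σ (Q * Matrix.of y) Q) :=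
      hf.comp ((continuous_glueBlocks σ).comp
        ((continuous_id.matrix_mul continuous_const).prodMk continuous_id))
    have hψy : Continuous fun p : ℝ × (ι → κ → ℝ) => ψ (p.1 • y - p.2) :=
      hψ.comp ((continuous_fst.smul continuous_const).sub continuous_snd)
    have h1 := (hfy.tendsto _).comp hQ
    have h2 := (hψy.tendsto (0, slopeBlock σ M₀)).comp
      (hη.prodMk_nhds hw)
    have h3 := h1.mul h2
    simp only [← ENNReal.coe_mul]
    exact ENNReal.tendsto_coe.2 h3

end Kernel

lemma actTuple_smul {ι ν : Type*} [Fintype ν] (g : Matrix ν ν ℝ) (r : ℝ) (M : ι → ν → ℝ) :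
    actTuple g (r • M) = r • actTuple g M := by
  funext i
  simp [actTuple, Matrix.mulVec_smul]

section Average

variable {ι κ ν : Type*} [Fintype ι] [Fintype κ] [Fintype ν] [DecidableEq ι]
  (σ : κ ⊕ ι ≃ ν) {f : (ι → ν → ℝ) → ℝ≥0} {ψ : (ι → κ → ℝ) → ℝ≥0}

lemma tendsto_lintegral_shearAverage [DecidableEq ν] (hf : Continuous f) (hfc : HasCompactSupport f)
    (hfU : tsupport f ⊆ {M | (pivotBlock σ M).det ≠ 0})
    (hψ : Continuous ψ) (hψc : HasCompactSupport ψ) {η : ℕ → ℝ} (hη : Tendsto η atTop (𝓝 0))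
    (hη0 : ∀ N, 0 ≤ η N) (hη1 : ∀ N, η N ≤ 1) {g : Matrix ν ν ℝ} (hg : g.det = 1)
    {T : ℕ → (ι → ν → ℝ) → (ι → ν → ℝ)} (hT : ∀ M, Tendsto (fun N => T N M) atTop (𝓝 M))
    (hT1 : ∀ N M, dist (T N M) M ≤ 1)
    (hmeas : ∀ N, Measurable fun M => shearAverage σ f ψ (η N) (actTuple g (T N M))) :
    Tendsto (fun N => ∫⁻ M, shearAverage σ f ψ (η N) (actTuple g (T N M))) atTop
      (𝓝 (∫⁻ M, shearAverage σ f ψ 0 (actTuple g M))) := by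
  obtain ⟨C, hC⟩ := exists_bound_shearAverage σ hf hfc hfU hψ hψc
  obtain ⟨R, hR⟩ := exists_norm_le_of_shearAverage_ne_zero (ψ := ψ) σ hfc hfU hψc
  have hgi : g⁻¹ * g = 1 := Matrix.nonsing_inv_mul _ (by simp [hg])
  obtain ⟨R', hR'⟩ := ((isCompact_closedBall (0 : ι → ν → ℝ) R).image
    (continuous_actTuple (g := fun _ => g⁻¹) continuous_const continuous_id)).isBounded.exists_norm_le
  refine tendsto_lintegral_of_dominated_convergence
    ((Metric.closedBall (0 : ι → ν → ℝ) (R' + 1)).indicator (fun _ => (C : ℝ≥0∞)))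
    hmeas (fun N => ?_) ?_ ?_
  · refine Eventually.of_forall fun M => ?_
    dsimp only
    by_cases h0 : shearAverage σ f ψ (η N) (actTuple g (T N M)) = 0
    · simp [h0]
    · rw [Set.indicator_of_mem]
      · exact hC _ _
      · have h1 := hR _ _ (hη0 N) (hη1 N) h0
        have h2 := hR' _ ⟨actTuple g (T N M), by simpa using h1, rfl⟩
        simp only [id, ← actTuple_mul, hgi, actTuple_one] at h2
        rw [mem_closedBall_zero_iff]
        have h3 : ‖M‖ ≤ ‖T N M‖ + dist (T N M) M := by
          rw [dist_eq_norm]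
          simpa using norm_sub_le (T N M) (T N M - M)
        linarith [hT1 N M]
  · rw [lintegral_indicator_const Metric.isClosed_closedBall.measurableSet]
    exact ENNReal.mul_ne_top ENNReal.coe_ne_top measure_closedBall_lt_top.ne
  · have hae : ∀ᵐ M : ι → ν → ℝ, (pivotBlock σ M).det ≠ 0 := by
      rw [ae_iff]
      simpa using volume_det_pivotBlock_eq_zero σ
    filter_upwards [(measurePreserving_actTuple g hg).quasiMeasurePreserving.ae hae] with M hM
    refine tendsto_shearAverage σ hf hfc hfU hψ hψc hη ?_ hM
    exact ((continuous_actTuple (g := fun _ => g) continuous_const continuous_id).tendsto M).comp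
      (hT M)

variable [DecidableEq κ]

lemma shearAverage_eq (hf : Continuous f) (hfU : tsupport f ⊆ {M | (pivotBlock σ M).det ≠ 0})
    (hψ : Continuous ψ) {α r : ℝ} (hα : 0 < α) (hr : 0 < r)
    (hαr : α ^ Fintype.card κ = r ^ Fintype.card ι) (M : ι → ν → ℝ) :
    ENNReal.ofReal (r ^ (Fintype.card ι * Fintype.card ν)) *
      ∫⁻ t : ι → κ → ℝ, (f (actTuple (shearMatrix σ α r⁻¹ (Matrix.of t)) (r • M)) : ℝ≥0∞) * ψ t
      = shearAverage σ f ψ (α * r)⁻¹ M := by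
  have hf0 (P : Matrix ι κ ℝ) (Q : Matrix ι ι ℝ) (hQ : Q.det = 0) : f (glueBlocks σ P Q) = 0 := by
    by_contra hne
    have := hfU (subset_tsupport f hne)
    simp [hQ] at this
  have hp : pivotBlock σ (r • M) = r • pivotBlock σ M := rfl
  have hfr : freeBlock σ (r • M) = r • freeBlock σ M := rfl
  have hrw (t : ι → κ → ℝ) : actTuple (shearMatrix σ α r⁻¹ (Matrix.of t)) (r • M)
      = glueBlocks σ ((α * r) • (freeBlock σ M + pivotBlock σ M * Matrix.of t))
        (pivotBlock σ M) := by
    rw [actTuple_shearMatrix, hp, hfr, smul_smul, inv_mul_cancel₀ hr.ne', one_smul,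
      Matrix.smul_mul, ← smul_add, smul_smul]
  simp_rw [hrw]
  by_cases hdet : (pivotBlock σ M).det = 0
  · simp [shearAverage, hf0 _ _ hdet]
  have hβ : 0 < α * r := by positivity
  have hcard : Fintype.card ν = Fintype.card κ + Fintype.card ι := by
    rw [← Fintype.card_congr σ, Fintype.card_sum]
  have hpow : r ^ (Fintype.card ι * Fintype.card ν)
      = (α * r) ^ Module.finrank ℝ (ι → κ → ℝ) := by
    have : Module.finrank ℝ (ι → κ → ℝ) = Fintype.card κ * Fintype.card ι := by
      simp [Module.finrank_pi_fintype, mul_comm]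
    calc r ^ (Fintype.card ι * Fintype.card ν)
        = (r ^ Fintype.card ι * r ^ Fintype.card κ) ^ Fintype.card ι := by
          rw [hcard, ← pow_add, ← pow_mul]
          ring
      _ = _ := by rw [← hαr, ← mul_pow, this, pow_mul]
  have hF : Measurable fun y : ι → κ → ℝ =>
      (f (glueBlocks σ (pivotBlock σ M * Matrix.of y) (pivotBlock σ M)) : ℝ≥0∞) :=
    (hf.comp ((continuous_glueBlocks σ).comp ((continuous_const.matrix_mul
      continuous_of_matrix).prodMk continuous_const))).measurable.coe_nnreal_ennreal
  rw [hpow, shearAverage, ← lintegral_comp_smul_add volume hβ (slopeBlock σ M) hF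
    hψ.measurable.coe_nnreal_ennreal]
  congr 1
  refine lintegral_congr fun t => ?_
  congr 4
  have h1 : pivotBlock σ M * Matrix.of (slopeBlock σ M) = freeBlock σ M :=
    Matrix.mul_nonsing_inv_cancel_left _ _ (isUnit_iff_ne_zero.2 hdet)
  have h2 : Matrix.of ((α * r) • (slopeBlock σ M + t))
    = (α * r) • (Matrix.of (slopeBlock σ M) + Matrix.of t) := rfl
  rw [h2, Matrix.mul_smul, Matrix.mul_add, h1]

lemma measurable_shearMatrix_integrand (hf : Continuous f) (hψ : Continuous ψ) (a b : ℝ) :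
    Measurable fun p : (ι → ν → ℝ) × (ι → κ → ℝ) =>
      (f (actTuple (shearMatrix σ a b (Matrix.of p.2)) p.1) : ℝ≥0∞) * ψ p.2 := by
  have h1 : Continuous fun p : (ι → ν → ℝ) × (ι → κ → ℝ) =>
      f (actTuple (shearMatrix σ a b (Matrix.of p.2)) p.1) :=
    hf.comp (continuous_actTuple ((continuous_shearMatrix σ a b).comp
      (continuous_of_matrix.comp continuous_snd)) continuous_fst)
  exact h1.measurable.coe_nnreal_ennreal.mul
    (hψ.comp continuous_snd).measurable.coe_nnreal_ennreal

lemma measurable_shear_integrand (hf : Continuous f) (hψ : Continuous ψ) (a b : ℝ)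
    (M : ι → ν → ℝ) :
    Measurable fun t : ι → κ → ℝ =>
      (f (actTuple (shearMatrix σ a b (Matrix.of t)) M) : ℝ≥0∞) * ψ t := by
  have h1 : Continuous fun t : ι → κ → ℝ =>
      f (actTuple (shearMatrix σ a b (Matrix.of t)) M) :=
    hf.comp (continuous_actTuple ((continuous_shearMatrix σ a b).comp continuous_of_matrix)
      continuous_const)
  exact h1.measurable.coe_nnreal_ennreal.mul hψ.measurable.coe_nnreal_ennreal

lemma measurable_shear_lintegral (hf : Continuous f) (hψ : Continuous ψ) (a b : ℝ) :
    Measurable fun M : ι → ν → ℝ => ∫⁻ t : ι → κ → ℝ,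
      (f (actTuple (shearMatrix σ a b (Matrix.of t)) M) : ℝ≥0∞) * ψ t :=
  (measurable_shearMatrix_integrand σ hf hψ a b).lintegral_prod_right'

lemma measurable_smul_tuple {ι ν : Type*} [Fintype ι] [Fintype ν] (r : ℝ) :
    Measurable fun M : ι → ν → ℝ => r • M :=
  (continuous_const_smul r).measurable

lemma measurable_shearAverage (hf : Continuous f)
    (hfU : tsupport f ⊆ {M | (pivotBlock σ M).det ≠ 0}) (hψ : Continuous ψ) {α r : ℝ}
    (hα : 0 < α) (hr : 0 < r) (hαr : α ^ Fintype.card κ = r ^ Fintype.card ι) :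
    Measurable (shearAverage σ f ψ (α * r)⁻¹) := by
  rw [← funext (shearAverage_eq σ hf hfU hψ hα hr hαr)]
  exact ((measurable_shear_lintegral σ hf hψ α r⁻¹).comp (measurable_smul_tuple r)).const_mul _

lemma lintegral_tsum_shear (hf : Continuous f)
    (hfU : tsupport f ⊆ {M | (pivotBlock σ M).det ≠ 0}) (hψ : Continuous ψ)
    {α r : ℝ} (hα : 0 < α) (hr : 0 < r) (hαr : α ^ Fintype.card κ = r ^ Fintype.card ι)
    (g : Matrix ν ν ℝ) :
    ∫⁻ t : ι → κ → ℝ, (∑' z : ι → ν → ℤ,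
      (f (actTuple (shearMatrix σ α r⁻¹ (Matrix.of t)) (actTuple g (castTuple z))) : ℝ≥0∞)) * ψ t
      = ∫⁻ M, shearAverage σ f ψ (α * r)⁻¹
          (actTuple g (r⁻¹ • castTuple (floorTuple r M))) := by
  have hmz (z : ι → ν → ℤ) := measurable_shear_integrand σ hf hψ α r⁻¹ (actTuple g (castTuple z))
  simp_rw [← ENNReal.tsum_mul_right]
  rw [lintegral_tsum fun z => (hmz z).aemeasurable]
  refine (tsum_eq_lintegral_floorTuple hr fun z => ∫⁻ t : ι → κ → ℝ,
    (f (actTuple (shearMatrix σ α r⁻¹ (Matrix.of t)) (actTuple g (castTuple z))) : ℝ≥0∞) *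
      ψ t).trans ?_
  refine lintegral_congr fun M => ?_
  rw [← shearAverage_eq σ hf hfU hψ hα hr hαr, ← actTuple_smul, smul_smul, mul_inv_cancel₀ hr.ne',
    one_smul]

variable [DecidableEq ν]

lemma lintegral_shearAverage (hf : Continuous f)
    (hfU : tsupport f ⊆ {M | (pivotBlock σ M).det ≠ 0}) (hψ : Continuous ψ)
    (hψ1 : ∫⁻ t, (ψ t : ℝ≥0∞) = 1) {α r : ℝ} (hα : 0 < α) (hr : 0 < r)
    (hαr : α ^ Fintype.card κ = r ^ Fintype.card ι) :
    ∫⁻ M, shearAverage σ f ψ (α * r)⁻¹ M = ∫⁻ M, (f M : ℝ≥0∞) := by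
  have hΦm := measurable_shear_lintegral σ hf hψ α r⁻¹
  have h1 : ∫⁻ M, shearAverage σ f ψ (α * r)⁻¹ M = ∫⁻ M : ι → ν → ℝ, ∫⁻ t : ι → κ → ℝ,
      (f (actTuple (shearMatrix σ α r⁻¹ (Matrix.of t)) M) : ℝ≥0∞) * ψ t := by
    have h2 := lintegral_comp_smul_add (volume : Measure (ι → ν → ℝ)) hr 0 hΦm
      (measurable_const (a := (1 : ℝ≥0∞)))
    have h3 : Module.finrank ℝ (ι → ν → ℝ) = Fintype.card ι * Fintype.card ν := by
      simp [Module.finrank_pi_fintype]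
    simp only [mul_one, zero_add, h3] at h2
    rw [← h2]
    refine Eq.trans ?_ (lintegral_const_mul _ (hΦm.comp (measurable_smul_tuple r)))
    exact lintegral_congr fun M => (shearAverage_eq σ hf hfU hψ hα hr hαr M).symm
  have hfm : Measurable fun M => (f M : ℝ≥0∞) := hf.measurable.coe_nnreal_ennreal
  have hdet (t : Matrix ι κ ℝ) : (shearMatrix σ α r⁻¹ t).det = 1 := by
    rw [det_shearMatrix, hαr, ← mul_pow, mul_inv_cancel₀ hr.ne', one_pow]
  rw [h1, lintegral_lintegral_swap (measurable_shearMatrix_integrand σ hf hψ α r⁻¹).aemeasurable]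
  have h4 (t : ι → κ → ℝ) : ∫⁻ M, (f (actTuple (shearMatrix σ α r⁻¹ (Matrix.of t)) M)
      : ℝ≥0∞) * ψ t = (∫⁻ M, (f M : ℝ≥0∞)) * ψ t := by
    rw [lintegral_mul_const' _ _ ENNReal.coe_ne_top,
      (measurePreserving_actTuple _ (hdet _)).lintegral_comp hfm]
  simp_rw [h4]
  rw [lintegral_const_mul _ hψ.measurable.coe_nnreal_ennreal, hψ1, mul_one]

/-- Averages over shears of the sum of `f` over the tuples of lattice vectors converge to the
integral of `f`. -/
lemma tendsto_average_tsum (hf : Continuous f) (hfc : HasCompactSupport f)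
    (hfU : tsupport f ⊆ {M | (pivotBlock σ M).det ≠ 0})
    (hψ : Continuous ψ) (hψc : HasCompactSupport ψ) (hψ1 : ∫⁻ t, (ψ t : ℝ≥0∞) = 1)
    {α r : ℕ → ℝ} (hα : ∀ N, 1 ≤ α N) (hr : ∀ N, 1 ≤ r N) (hrt : Tendsto r atTop atTop)
    (hαr : ∀ N, α N ^ Fintype.card κ = r N ^ Fintype.card ι)
    {g : Matrix ν ν ℝ} (hg : g.det = 1) :
    Tendsto (fun N => ∫⁻ t : ι → κ → ℝ, (∑' z : ι → ν → ℤ,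
      (f (actTuple (shearMatrix σ (α N) (r N)⁻¹ (Matrix.of t)) (actTuple g (castTuple z))) : ℝ≥0∞))
        * ψ t) atTop (𝓝 (∫⁻ M, (f M : ℝ≥0∞))) := by
  have hα0 N : 0 < α N := one_pos.trans_le (hα N)
  have hr0 N : 0 < r N := one_pos.trans_le (hr N)
  have hKm N : Measurable (shearAverage σ f ψ (α N * r N)⁻¹) :=
    measurable_shearAverage σ hf hfU hψ (hα0 N) (hr0 N) (hαr N)
  have hgm : Measurable (actTuple g : (ι → ν → ℝ) → _) :=
    (continuous_actTuple (g := fun _ => g) continuous_const continuous_id).measurable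
  have hη0 N : 0 ≤ (α N * r N)⁻¹ := (inv_pos.2 (mul_pos (hα0 N) (hr0 N))).le
  have hη1 N : (α N * r N)⁻¹ ≤ 1 :=
    inv_le_one_of_one_le₀ (one_le_mul_of_one_le_of_one_le (hα N) (hr N))
  have hαrt : Tendsto (fun N => α N * r N) atTop atTop :=
    tendsto_atTop_mono (fun N => le_mul_of_one_le_left (hr0 N).le (hα N)) hrt
  have hη : Tendsto (fun N => (α N * r N)⁻¹) atTop (𝓝 0) := tendsto_inv_atTop_zero.comp hαrt
  have hTd N (M : ι → ν → ℝ) : dist ((r N)⁻¹ • castTuple (floorTuple (r N) M)) M ≤ (r N)⁻¹ :=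
    dist_floorTuple_le (hr0 N) M
  have hTm N : Measurable fun M : ι → ν → ℝ => (r N)⁻¹ • castTuple (floorTuple (r N) M) := by
    have hc : Measurable (castTuple : (ι → ν → ℤ) → (ι → ν → ℝ)) := measurable_of_countable _
    exact (measurable_smul_tuple (r N)⁻¹).comp (hc.comp (measurable_floorTuple (r N)))
  have hT (M : ι → ν → ℝ) :
      Tendsto (fun N => (r N)⁻¹ • castTuple (floorTuple (r N) M)) atTop (𝓝 M) := by
    rw [tendsto_iff_dist_tendsto_zero]
    exact squeeze_zero (fun _ => dist_nonneg) (fun N => hTd N M) (tendsto_inv_atTop_zero.comp hrt)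
  have hint (N : ℕ) : ∫⁻ M, shearAverage σ f ψ (α N * r N)⁻¹ (actTuple g M)
      = ∫⁻ M, (f M : ℝ≥0∞) := by
    rw [(measurePreserving_actTuple g hg).lintegral_comp (hKm N),
      lintegral_shearAverage σ hf hfU hψ hψ1 (hα0 N) (hr0 N) (hαr N)]
  have hlim1 := tendsto_lintegral_shearAverage σ hf hfc hfU hψ hψc hη hη0 hη1 hg hT
    (fun N M => (hTd N M).trans (inv_le_one_of_one_le₀ (hr N)))
    (fun N => (hKm N).comp (hgm.comp (hTm N)))
  have hlim2 := tendsto_lintegral_shearAverage σ hf hfc hfU hψ hψc hη hη0 hη1 hg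
    (T := fun _ M => M) (fun M => tendsto_const_nhds) (fun N M => by simp)
    (fun N => (hKm N).comp hgm)
  simp_rw [hint] at hlim2
  rw [tendsto_nhds_unique hlim2 tendsto_const_nhds] at hlim1
  simpa only [lintegral_tsum_shear σ hf hfU hψ (hα0 _) (hr0 _) (hαr _)] using hlim1

end Average

lemma exists_continuous_compactSupport_lintegral_eq_one (E : Type*) [NormedAddCommGroup E]
    [NormedSpace ℝ E] [MeasurableSpace E] [BorelSpace E] [FiniteDimensional ℝ E] (μ : Measure E)
    [μ.IsAddHaarMeasure] :
    ∃ ψ : E → ℝ≥0, Continuous ψ ∧ HasCompactSupport ψ ∧ ∫⁻ x, (ψ x : ℝ≥0∞) ∂μ = 1 := by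
  let b : ContDiffBump (0 : E) := default
  have hb : Continuous (b.normed μ) := (b.contDiff_normed (n := 0)).continuous
  refine ⟨fun x => (b.normed μ x).toNNReal, continuous_real_toNNReal.comp hb,
    b.hasCompactSupport_normed.comp_left Real.toNNReal_zero, ?_⟩
  change ∫⁻ x, ENNReal.ofReal (b.normed μ x) ∂μ = 1
  rw [← ofReal_integral_eq_lintegral_ofReal b.integrable_normed
    (Eventually.of_forall b.nonneg_normed), b.integral_normed, ENNReal.ofReal_one]

/-- Mean value formula for compactly supported continuous functions supported in the tuples
with nonsingular pivot block. -/
lemma lintegral_latticeSum_of_tsupport_subset {n k : ℕ} {κ : Type*} [Fintype κ] [Nonempty κ]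
    (σ : κ ⊕ Fin k ≃ Fin n) (μ : Measure (LatticeSpace n)) [IsProbabilityMeasure μ]
    (hinv : ∀ g : SLR n, Measure.map (fun x => g • x) μ = μ)
    {f : (Fin k → Fin n → ℝ) → ℝ≥0} (hf : Continuous f) (hfc : HasCompactSupport f)
    (hfU : tsupport f ⊆ {M | (pivotBlock σ M).det ≠ 0}) :
    ∫⁻ L, latticeSum L (fun M => (f M : ℝ≥0∞)) ∂μ = ∫⁻ M, (f M : ℝ≥0∞) := by
  classical
  obtain ⟨ψ, hψ, hψc, hψ1⟩ := exists_continuous_compactSupport_lintegral_eq_one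
    (Fin k → κ → ℝ) volume
  have hψm : Measurable fun t => (ψ t : ℝ≥0∞) := hψ.measurable.coe_nnreal_ennreal
  let P : Measure (Fin k → κ → ℝ) := volume.withDensity fun t => ψ t
  have hP : IsProbabilityMeasure P := ⟨by simp [P, hψ1]⟩
  let r (N : ℕ) : ℝ := N + 1
  let α (N : ℕ) : ℝ := r N ^ ((k : ℝ) / Fintype.card κ)
  have hr (N : ℕ) : 1 ≤ r N := by simp [r]
  have hr0 (N : ℕ) : 0 < r N := one_pos.trans_le (hr N)
  have hα (N : ℕ) : 1 ≤ α N := Real.one_le_rpow (hr N) (by positivity)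
  have hαr (N : ℕ) : α N ^ Fintype.card κ = r N ^ Fintype.card (Fin k) := by
    have : (Fintype.card κ : ℝ) ≠ 0 := by simp
    rw [← Real.rpow_natCast, ← Real.rpow_mul (hr0 N).le, div_mul_cancel₀ _ this,
      Real.rpow_natCast, Fintype.card_fin]
  have hrt : Tendsto r atTop atTop :=
    tendsto_atTop_add_const_right _ _ tendsto_natCast_atTop_atTop
  let G (N : ℕ) (t : Fin k → κ → ℝ) : SLR n := ⟨shearMatrix σ (α N) (r N)⁻¹ (Matrix.of t), by
    rw [det_shearMatrix, hαr, ← mul_pow, mul_inv_cancel₀ (hr0 N).ne', one_pow]⟩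
  have hG (N : ℕ) : Measurable (G N) := by
    refine Continuous.measurable ?_
    rw [(isClosedEmbedding_coe n).isInducing.continuous_iff]
    exact (continuous_shearMatrix σ (α N) (r N)⁻¹).comp continuous_of_matrix
  have hΘ : Measurable fun L : LatticeSpace n => latticeSum L (fun M => (f M : ℝ≥0∞)) :=
    measurable_latticeSum hf.measurable.coe_nnreal_ennreal
  refine lintegral_eq_of_tendsto_average P μ hinv G hG hΘ _ fun L => ?_
  refine (tendsto_average_tsum σ hf hfc hfU hψ hψc hψ1 hα hr hrt hαr
    (Quotient.out (α := SLR n) L).2).congr fun N => ?_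
  have hm : Measurable fun t => latticeSum (G N t • L) (fun M => (f M : ℝ≥0∞)) :=
    hΘ.comp ((continuous_id.smul continuous_const).measurable.comp (hG N))
  rw [lintegral_withDensity_eq_lintegral_mul _ hψm hm]
  refine lintegral_congr fun t => ?_
  rw [Pi.mul_apply, latticeSum_smul, mul_comm]
  rfl

lemma IsOpen.measure_eq_iSup_isCompact_nat {X : Type*} [PseudoMetricSpace X] [ProperSpace X]
    [MeasurableSpace X] {V : Set X} (hV : IsOpen V) :
    ∃ K : ℕ → Set X, (∀ j, IsCompact (K j)) ∧ (∀ j, K j ⊆ V) ∧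
      ∀ μ : Measure X, μ V = ⨆ j, μ (K j) := by
  rcases isEmpty_or_nonempty X with hX | ⟨⟨x⟩⟩
  · exact ⟨fun _ => ∅, fun _ => isCompact_empty, fun _ => Set.empty_subset _, fun μ => by
      simp [Set.eq_empty_of_isEmpty V]⟩
  obtain ⟨F, hF, hFV, hFU, hFm⟩ := hV.exists_iUnion_isClosed
  refine ⟨fun j => F j ∩ Metric.closedBall x j,
    fun j => (isCompact_closedBall x _).inter_left (hF j),
    fun j => Set.inter_subset_left.trans (hFV j), fun μ => ?_⟩
  have hm : Monotone fun j : ℕ => F j ∩ Metric.closedBall x (j : ℝ) := fun i j hij =>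
    Set.inter_subset_inter (hFm hij) (Metric.closedBall_subset_closedBall (by exact_mod_cast hij))
  rw [← hm.measure_iUnion, Set.iUnion_inter_of_monotone hFm fun i j hij =>
    Metric.closedBall_subset_closedBall (by exact_mod_cast hij), hFU,
    Metric.iUnion_closedBall_nat, Set.inter_univ]

/-- Two measures agree inside an open set as soon as they integrate the compactly supported
continuous functions supported in that set in the same way. -/
lemma restrict_eq_restrict_of_lintegral_eq {X : Type*} [MetricSpace X] [ProperSpace X]
    [MeasurableSpace X] [BorelSpace X] {μ ν : Measure X} [IsFiniteMeasureOnCompacts ν]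
    {U : Set X} (hU : IsOpen U)
    (h : ∀ f : X → ℝ≥0, Continuous f → HasCompactSupport f → tsupport f ⊆ U →
      ∫⁻ x, (f x : ℝ≥0∞) ∂μ = ∫⁻ x, (f x : ℝ≥0∞) ∂ν) :
    μ.restrict U = ν.restrict U := by
  have key {K V : Set X} (hK : IsCompact K) (hV : IsOpen V) (hVU : V ⊆ U) (hKV : K ⊆ V) :
      μ K ≤ ν V ∧ ν K ≤ μ V := by
    obtain ⟨k, hk, hKk, hkV⟩ := exists_compact_between hK hV hKV
    obtain ⟨f, hf1, hf0, -, hf⟩ := exists_continuous_one_zero_of_isCompact hK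
      (isOpen_interior (s := k)).isClosed_compl (Set.disjoint_compl_right_iff_subset.2 hKk)
    have hfk : Function.support (fun x => (f x).toNNReal) ⊆ k := fun x hx => by
      by_contra hxk
      have : f x = 0 := hf0 fun hx' => hxk (interior_subset hx')
      simp [this] at hx
    have hts : tsupport (fun x => (f x).toNNReal) ⊆ k := closure_minimal hfk hk.isClosed
    have hint := h (fun x => (f x).toNNReal) (continuous_real_toNNReal.comp f.continuous)
      (hk.of_isClosed_subset (isClosed_tsupport _) hts) (hts.trans (hkV.trans hVU))
    have hlow (ρ : Measure X) : ρ K ≤ ∫⁻ x, ((f x).toNNReal : ℝ≥0∞) ∂ρ := by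
      rw [← lintegral_indicator_one hK.isClosed.measurableSet]
      refine lintegral_mono fun x => ?_
      by_cases hx : x ∈ K
      · have : f x = 1 := hf1 hx
        simp [hx, this]
      · simp [hx]
    have hupp (ρ : Measure X) : ∫⁻ x, ((f x).toNNReal : ℝ≥0∞) ∂ρ ≤ ρ V := by
      rw [← lintegral_indicator_one hV.measurableSet]
      refine lintegral_mono fun x => ?_
      by_cases hx : x ∈ V
      · simpa [hx] using (hf x).2
      · have : (f x).toNNReal = 0 := by
          by_contra hne
          exact hx (hkV (hfk hne))
        simp [this]
    exact ⟨(hlow μ).trans (hint.trans_le (hupp ν)), (hlow ν).trans (hint.symm.trans_le (hupp μ))⟩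
  have hopen {V : Set X} (hV : IsOpen V) (hVU : V ⊆ U) : μ V = ν V := by
    obtain ⟨K, hK, hKV, hsup⟩ := hV.measure_eq_iSup_isCompact_nat
    apply le_antisymm
    · rw [hsup μ]
      exact iSup_le fun j => (key (hK j) hV hVU (hKV j)).1
    · rw [hsup ν]
      exact iSup_le fun j => (key (hK j) hV hVU (hKV j)).2
  rcases isEmpty_or_nonempty X with hX | ⟨⟨x⟩⟩
  · exact Subsingleton.elim _ _
  have hr {V : Set X} (hV : IsOpen V) : μ.restrict U V = ν.restrict U V := by
    rw [Measure.restrict_apply hV.measurableSet, Measure.restrict_apply hV.measurableSet]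
    exact hopen (hV.inter hU) Set.inter_subset_right
  refine Measure.ext_of_generateFrom_of_iUnion {V | IsOpen V} (fun j : ℕ => Metric.ball x j)
    BorelSpace.measurable_eq isPiSystem_isOpen (Metric.iUnion_ball_nat x)
    (fun j => Metric.isOpen_ball) (fun j => ?_) (fun V hV => hr hV)
  rw [hr Metric.isOpen_ball]
  exact (Measure.restrict_apply_le _ _).trans_lt measure_ball_lt_top |>.ne

/-- The counting measure on the `k`-tuples of vectors in the lattice `L`. -/
def tupleMeasure {n : ℕ} (k : ℕ) (L : LatticeSpace n) : Measure (Fin k → Fin n → ℝ) :=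
  Measure.sum fun z : Fin k → Fin n → ℤ =>
    Measure.dirac (actTuple (Quotient.out (α := SLR n) L).1 (castTuple z))

lemma lintegral_tupleMeasure {n k : ℕ} (L : LatticeSpace n) {f : (Fin k → Fin n → ℝ) → ℝ≥0∞}
    (hf : Measurable f) : ∫⁻ M, f M ∂tupleMeasure k L = latticeSum L f := by
  simp [tupleMeasure, latticeSum, lintegral_sum_measure, lintegral_dirac' _ hf]

lemma measurable_tupleMeasure (n k : ℕ) :
    Measurable (tupleMeasure k : LatticeSpace n → Measure (Fin k → Fin n → ℝ)) := by
  refine Measure.measurable_of_measurable_coe _ fun s hs => ?_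
  simp_rw [← lintegral_indicator_one hs]
  simp_rw [lintegral_tupleMeasure _ (measurable_one.indicator hs)]
  exact measurable_latticeSum (measurable_one.indicator hs)

/-- The intensity measure of the `k`-tuples of vectors in a random lattice. -/
def intensity {n : ℕ} (k : ℕ) (μ : Measure (LatticeSpace n)) : Measure (Fin k → Fin n → ℝ) :=
  μ.bind (tupleMeasure k)

lemma lintegral_intensity {n k : ℕ} (μ : Measure (LatticeSpace n))
    {f : (Fin k → Fin n → ℝ) → ℝ≥0∞} (hf : Measurable f) :
    ∫⁻ M, f M ∂intensity k μ = ∫⁻ L, latticeSum L f ∂μ := by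
  rw [intensity, Measure.lintegral_bind (measurable_tupleMeasure n k).aemeasurable hf.aemeasurable]
  simp_rw [lintegral_tupleMeasure _ hf]

def pivotEquiv {k n : ℕ} (a : Fin k ↪ Fin n) : ↥(Set.range a)ᶜ ⊕ Fin k ≃ Fin n :=
  (Equiv.sumComm _ _).trans (((Equiv.ofInjective a a.injective).sumCongr (Equiv.refl _)).trans
    (Equiv.Set.sumCompl (Set.range a)))

@[simp] lemma pivotEquiv_inr {k n : ℕ} (a : Fin k ↪ Fin n) (j : Fin k) :
    pivotEquiv a (Sum.inr j) = a j := by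
  simp [pivotEquiv]

lemma linearIndependent_iff_exists_pivot {k n : ℕ} (M : Fin k → Fin n → ℝ) :
    LinearIndependent ℝ M ↔ ∃ a : Fin k ↪ Fin n, (pivotBlock (pivotEquiv a) M).det ≠ 0 := by
  constructor
  · intro h
    let A : Matrix (Fin k) (Fin n) ℝ := Matrix.of M
    have hr : A.rank = k := by
      have : LinearIndependent ℝ A.row := h
      simpa using this.rank_matrix
    have hspan : Submodule.span ℝ (Set.range A.col) = ⊤ := by
      refine Submodule.eq_top_of_finrank_eq ?_
      rw [← Matrix.rank_eq_finrank_span_cols, hr]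
      simp
    obtain ⟨ι, a, ha, has, hal⟩ := exists_linearIndependent' ℝ A.col
    rw [hspan] at has
    let b := Module.Basis.mk hal has.ge
    have : Fintype ι := FiniteDimensional.fintypeBasisIndex b
    have hc : Fintype.card (Fin k) = Fintype.card ι := by
      rw [← Module.finrank_eq_card_basis b]
      simp
    let e : Fin k ≃ ι := Fintype.equivOfCardEq hc
    refine ⟨⟨a ∘ e, ha.comp e.injective⟩, ?_⟩
    have hl : LinearIndependent ℝ (pivotBlock (pivotEquiv ⟨a ∘ e, ha.comp e.injective⟩) M).col := by
      have hcol : (pivotBlock (pivotEquiv ⟨a ∘ e, ha.comp e.injective⟩) M).col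
          = (A.col ∘ a) ∘ e := by
        ext i j
        exact congrArg (M j) (pivotEquiv_inr ⟨a ∘ e, ha.comp e.injective⟩ i)
      rw [hcol]
      exact hal.comp e e.injective
    exact ((Matrix.isUnit_iff_isUnit_det _).1 (Matrix.linearIndependent_cols_iff_isUnit.1 hl)).ne_zero
  · rintro ⟨a, ha⟩
    have h1 := Matrix.linearIndependent_rows_of_det_ne_zero ha
    refine LinearIndependent.of_comp (LinearMap.funLeft ℝ ℝ a) ?_
    have hrow : LinearMap.funLeft ℝ ℝ a ∘ M = fun i => pivotBlock (pivotEquiv a) M i := by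
      ext i j
      simp [pivotBlock]
    rw [hrow]
    exact h1

lemma isOpen_linearIndependent (k n : ℕ) :
    IsOpen {M : Fin k → Fin n → ℝ | LinearIndependent ℝ M} := by
  have : {M : Fin k → Fin n → ℝ | LinearIndependent ℝ M}
      = ⋃ a : Fin k ↪ Fin n, {M | (pivotBlock (pivotEquiv a) M).det ≠ 0} := by
    ext M
    simp [linearIndependent_iff_exists_pivot]
  rw [this]
  exact isOpen_iUnion fun a =>
    isOpen_ne_fun (continuous_pivotBlock _).matrix_det continuous_const

/-- The intensity measure agrees with Lebesgue measure on the linearly independent tuples. -/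
lemma intensity_restrict_linearIndependent {n k : ℕ} (hk : k < n) (μ : Measure (LatticeSpace n))
    [IsProbabilityMeasure μ] (hinv : ∀ g : SLR n, Measure.map (fun x => g • x) μ = μ) :
    (intensity k μ).restrict {M | LinearIndependent ℝ M}
      = volume.restrict {M | LinearIndependent ℝ M} := by
  have : {M : Fin k → Fin n → ℝ | LinearIndependent ℝ M}
      = ⋃ a : Fin k ↪ Fin n, {M | (pivotBlock (pivotEquiv a) M).det ≠ 0} := by
    ext M
    simp [linearIndependent_iff_exists_pivot]
  rw [this, Measure.restrict_iUnion_congr]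
  intro a
  classical
  have hne : Nonempty ↥(Set.range a)ᶜ := by
    by_contra h
    have hs : Function.Surjective a := by
      simpa [Set.isEmpty_coe_sort, Set.compl_empty_iff, Set.range_eq_univ, Function.Surjective]
        using h
    exact hk.not_ge (by simpa using Fintype.card_le_of_surjective a hs)
  refine restrict_eq_restrict_of_lintegral_eq
    (isOpen_ne_fun (continuous_pivotBlock _).matrix_det continuous_const) fun f hf hfc hfU => ?_
  rw [lintegral_intensity μ hf.measurable.coe_nnreal_ennreal]
  exact lintegral_latticeSum_of_tsupport_subset (pivotEquiv a) μ hinv hf hfc hfU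

lemma volume_compl_linearIndependent {n k : ℕ} (hk : k ≤ n) :
    volume {M : Fin k → Fin n → ℝ | LinearIndependent ℝ M}ᶜ = 0 := by
  refine measure_mono_null (fun M hM => ?_)
    (volume_det_pivotBlock_eq_zero (pivotEquiv (Fin.castLEEmb hk)))
  by_contra h
  exact hM ((linearIndependent_iff_exists_pivot M).2 ⟨_, h⟩)

lemma setOf_independent_tuples_eq {n : ℕ} (k : ℕ) (S : Set (Fin n → ℝ)) :
    {M : Fin k → Fin n → ℝ | (∀ i, M i ∈ S) ∧ LinearIndependent ℝ M}
      = (Set.univ.pi fun _ => S) ∩ {M | LinearIndependent ℝ M} := by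
  ext M
  simp

lemma measurableSet_independent_tuples {n : ℕ} (k : ℕ) {S : Set (Fin n → ℝ)}
    (hS : MeasurableSet S) :
    MeasurableSet {M : Fin k → Fin n → ℝ | (∀ i, M i ∈ S) ∧ LinearIndependent ℝ M} := by
  rw [setOf_independent_tuples_eq]
  exact (MeasurableSet.univ_pi fun _ => hS).inter (isOpen_linearIndependent k n).measurableSet

lemma lintegral_latticeSum_linearIndependent {n k : ℕ} (hk : k < n) (μ : Measure (LatticeSpace n))
    [IsProbabilityMeasure μ] (hinv : ∀ g : SLR n, Measure.map (fun x => g • x) μ = μ)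
    {S : Set (Fin n → ℝ)} (hS : MeasurableSet S) :
    ∫⁻ L, latticeSum L ({M : Fin k → Fin n → ℝ | (∀ i, M i ∈ S) ∧ LinearIndependent ℝ M}.indicator
      1) ∂μ = volume S ^ k := by
  have hE := measurableSet_independent_tuples k hS
  rw [← lintegral_intensity μ (measurable_one.indicator hE), lintegral_indicator_one hE,
    setOf_independent_tuples_eq, ← Measure.restrict_apply (MeasurableSet.univ_pi fun _ => hS),
    intensity_restrict_linearIndependent hk μ hinv,
    Measure.restrict_apply (MeasurableSet.univ_pi fun _ => hS),
    measure_inter_conull (volume_compl_linearIndependent hk.le), volume_pi_pi]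
  simp

lemma finite_of_ncard_eq_rankOf {n : ℕ} {X : Set (Fin n → ℝ)} (h : X.ncard = rankOf X) :
    X.Finite := by
  by_contra hX
  have h0 : rankOf X = 0 := by rw [← h, Set.Infinite.ncard hX]
  rw [rankOf, Submodule.finrank_eq_zero, Submodule.span_eq_bot] at h0
  exact hX ((Set.finite_singleton 0).subset h0)

/-- The subsets of `A` counted by `rho k k A`. -/
def independentSubsets {n : ℕ} (k : ℕ) (A : Set (Fin n → ℝ)) : Set (Set (Fin n → ℝ)) :=
  {X | X ⊆ A ∧ X.ncard = k ∧ rankOf X = k}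

/-- Each set counted by `rho k k A` has `k!` orderings, which are the linearly independent
`k`-tuples of elements of `A`. -/
lemma encard_linearIndependent_tuples {n k : ℕ} (A : Set (Fin n → ℝ)) :
    (({M : Fin k → Fin n → ℝ | (∀ i, M i ∈ A) ∧ LinearIndependent ℝ M}.encard : ℕ∞) : ℝ≥0∞)
      = (k.factorial : ℝ≥0∞) * ((independentSubsets k A).encard : ℕ∞) := by
  let Ψ : (Σ X : independentSubsets k A, Fin k ≃ X.1) → Fin k → Fin n → ℝ :=
    fun p i => (p.2 i : Fin n → ℝ)
  have hrange (p) : Set.range (Ψ p) = p.1.1 := by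
    ext x
    constructor
    · rintro ⟨i, rfl⟩
      exact (p.2 i).2
    · intro hx
      exact ⟨p.2.symm ⟨x, hx⟩, by simp [Ψ]⟩
  have hinj : Function.Injective Ψ := by
    rintro ⟨⟨X, hX⟩, e⟩ ⟨⟨Y, hY⟩, e'⟩ h
    have hXY : X = Y := (hrange ⟨⟨X, hX⟩, e⟩).symm.trans ((congrArg Set.range h).trans (hrange _))
    subst hXY
    congr 1
    ext i : 2
    exact congrFun h i
  have hΨ : {M : Fin k → Fin n → ℝ | (∀ i, M i ∈ A) ∧ LinearIndependent ℝ M} = Set.range Ψ := by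
    ext M
    constructor
    · rintro ⟨hA, hM⟩
      have hcard : (Set.range M).ncard = k := by
        rw [← Nat.card_coe_set_eq, Nat.card_range_of_injective hM.injective, Nat.card_fin]
      have hrank : rankOf (Set.range M) = k := by
        rw [rankOf, finrank_span_eq_card hM, Fintype.card_fin]
      exact ⟨⟨⟨Set.range M, Set.range_subset_iff.2 hA, hcard, hrank⟩,
        Equiv.ofInjective M hM.injective⟩, rfl⟩
    · rintro ⟨p, rfl⟩
      refine ⟨fun i => p.1.2.1 (p.2 i).2, ?_⟩
      rw [linearIndependent_iff_card_eq_finrank_span, Set.finrank, hrange, Fintype.card_fin]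
      exact p.1.2.2.2.symm
  have hfib (X : independentSubsets k A) : ∑' _ : Fin k ≃ X.1, (1 : ℝ≥0∞) = k.factorial := by
    have hf : X.1.Finite := finite_of_ncard_eq_rankOf (X.2.2.1.trans X.2.2.2.symm)
    have := hf.fintype
    classical
    have hc : Fintype.card X.1 = k := by
      rw [← Nat.card_eq_fintype_card, Nat.card_coe_set_eq, X.2.2.1]
    have e : Fin k ≃ X.1 := Fintype.equivOfCardEq (by simp [hc])
    simp [Fintype.card_equiv e]
  rw [hΨ, ← ENNReal.tsum_set_one, ← (Equiv.ofInjective Ψ hinj).tsum_eq, ENNReal.tsum_sigma']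
  simp_rw [hfib]
  rw [← ENNReal.tsum_set_one, ← ENNReal.tsum_mul_left]
  simp

lemma latticeSum_indicator {n k : ℕ} (L : LatticeSpace n) (S : Set (Fin n → ℝ)) :
    latticeSum L ({M : Fin k → Fin n → ℝ | (∀ i, M i ∈ S) ∧ LinearIndependent ℝ M}.indicator 1)
      = (k.factorial : ℝ≥0∞) * ((independentSubsets k (latticeOf L ∩ S)).encard : ℕ∞) := by
  set g : SLR n := Quotient.out (α := SLR n) L with hg
  let φ : (Fin k → Fin n → ℤ) → Fin k → Fin n → ℝ := fun z => actTuple g.1 (castTuple z)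
  have hgi : g.1⁻¹ * g.1 = 1 := Matrix.nonsing_inv_mul _ (by simp)
  have hφ : Function.Injective φ := by
    intro z w h
    have h1 : castTuple z = castTuple w := by
      rw [← actTuple_one (castTuple z), ← hgi, actTuple_mul, show actTuple g.1 (castTuple z)
        = actTuple g.1 (castTuple w) from h, ← actTuple_mul, hgi, actTuple_one]
    funext i j
    have h2 : (z i j : ℝ) = w i j := congrFun (congrFun h1 i) j
    exact_mod_cast h2
  rw [← encard_linearIndependent_tuples]
  have himg : {M : Fin k → Fin n → ℝ | (∀ i, M i ∈ latticeOf L ∩ S) ∧ LinearIndependent ℝ M}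
      = φ '' (φ ⁻¹' {M | (∀ i, M i ∈ S) ∧ LinearIndependent ℝ M}) := by
    rw [Set.image_preimage_eq_inter_range]
    ext M
    constructor
    · rintro ⟨hA, hM⟩
      choose v hv using fun i => (hA i).1
      exact ⟨⟨fun i => (hA i).2, hM⟩, v, funext fun i => (hv i).symm⟩
    · rintro ⟨⟨hS, hM⟩, z, rfl⟩
      exact ⟨fun i => ⟨⟨z i, rfl⟩, hS i⟩, hM⟩
  rw [himg, hφ.encard_image, ← ENNReal.tsum_set_one]
  exact (tsum_subtype _ fun _ => (1 : ℝ≥0∞)).symm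

end MeanValue

/-- **Siegel-type identity (1.9).** For a Borel set `S ⊆ ℝⁿ` with `S ∩ (-S) = ∅` and
`λ = Vol(S) ∈ (0, ∞)`, an `SL(n,ℝ)`-invariant Borel probability measure `μ` on the
space of covolume-one lattices, and `0 ≤ k ≤ n - 1`, the expected number of `k`-element
subsets of `L ∩ S` of rank `k` equals `λᵏ / k!`. -/
theorem expected_rho_k_k
    (n : ℕ) (hn : 1 ≤ n)
    (S : Set (Fin n → ℝ)) (hSmeas : MeasurableSet S)
    (hSsym : S ∩ (-S) = ∅) (hS0 : 0 < volume S) (hSfin : volume S < ⊤)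
    (μ : Measure (LatticeSpace n)) (hprob : IsProbabilityMeasure μ)
    (hinv : ∀ g : SLR n, Measure.map (fun x => g • x) μ = μ)
    (k : ℕ) (hk : k ≤ n - 1) :
    ∫⁻ L, (rho k k (latticeOf L ∩ S) : ℝ≥0∞) ∂μ
      = volume S ^ k / (Nat.factorial k : ℝ≥0∞) := by
  have hmean := lintegral_latticeSum_linearIndependent (k := k) (by omega) μ hinv hSmeas
  have hmeas : Measurable fun L : LatticeSpace n => latticeSum L
      ({M : Fin k → Fin n → ℝ | (∀ i, M i ∈ S) ∧ LinearIndependent ℝ M}.indicator 1) :=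
    measurable_latticeSum (measurable_one.indicator (measurableSet_independent_tuples k hSmeas))
  have hk0 : (k.factorial : ℝ≥0∞) ≠ 0 := by exact_mod_cast k.factorial_ne_zero
  have hkt : (k.factorial : ℝ≥0∞) ≠ ∞ := ENNReal.natCast_ne_top _
  rw [← hmean, div_eq_mul_inv, ← lintegral_mul_const _ hmeas]
  refine lintegral_congr_ae ?_
  filter_upwards [ae_lt_top hmeas (by rw [hmean]; exact ENNReal.pow_ne_top hSfin.ne)] with L hL
  rw [latticeSum_indicator] at hL ⊢
  rw [mul_right_comm, ENNReal.mul_inv_cancel hk0 hkt, one_mul]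
  have hfin : (independentSubsets k (latticeOf L ∩ S)).Finite := by
    rw [← Set.encard_ne_top_iff]
    intro htop
    simp [htop, hk0] at hL
  rw [← hfin.cast_ncard_eq]
  rfl
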